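/- arXiv:0809.1551 — 5 statements merged into one kernel-verified Lean document; each statement's English description precedes it below -/
import Mathlib

section
/- Characterization of repairs for ground full TGD and denial rules (Lemma 1 of the paper): For all instances I and I', the instance I' is a repair of I if and only if the following three conditions hold: (i) I' is consistent; (ii) T*(I' ∩ I) = I'; and (iii) there is no fact p ∈ I ∖ I' such that the instance J' = T*(I' ∪ {p}) is consistent and J' ∖ I = I' ∖ I. -/
/-!
Setting: facts form a type `F` with decidable equality, instances are finite sets of facts.
`T` is a finite set of ground full TGD rules (body, head) with nonempty bodies,
`D` a finite set of ground denial rules (nonempty sets of facts).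
-/

variable {F : Type*} [DecidableEq F]

/-- An instance `J` is consistent: every TGD rule whose body is contained in `J`
has its head in `J`, and no denial rule is a subset of `J`. -/
def DBConsistent (T : Finset (Finset F × F)) (D : Finset (Finset F)) (J : Finset F) : Prop :=
  (∀ r ∈ T, r.1 ⊆ J → r.2 ∈ J) ∧ ∀ d ∈ D, ¬ d ⊆ J

/-- Symmetric difference `Δ(I,J) = (I∖J) ∪ (J∖I)` of two instances. -/
def DBDelta (I J : Finset F) : Finset F := (I \ J) ∪ (J \ I)

/-- `I'` is a repair of `I`: a consistent instance such that no consistent instance `J`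
satisfies `Δ(I,J) ⊊ Δ(I,I')`. -/
def DBRepair (T : Finset (Finset F × F)) (D : Finset (Finset F)) (I I' : Finset F) : Prop :=
  DBConsistent T D I' ∧ ¬ ∃ J : Finset F, DBConsistent T D J ∧ DBDelta I J ⊂ DBDelta I I'

/-- A set of facts is closed under the TGD rules of `T`. -/
def DBClosedSet (T : Finset (Finset F × F)) (K : Set F) : Prop :=
  ∀ r ∈ T, (↑r.1 : Set F) ⊆ K → r.2 ∈ K

/-- `T*(J)`: the smallest superset of `J` that contains the head of every TGD rule of `T`
whose body it contains. -/
def DBClosure (T : Finset (Finset F × F)) (J : Finset F) : Set F :=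
  ⋂₀ {K : Set F | (↑J : Set F) ⊆ K ∧ DBClosedSet T K}

/-- Consistency for an arbitrary set of facts. -/
def DBConsistentSet (T : Finset (Finset F × F)) (D : Finset (Finset F)) (K : Set F) : Prop :=
  DBClosedSet T K ∧ ∀ d ∈ D, ¬ (↑d : Set F) ⊆ K

theorem subset_dbClosure (T : Finset (Finset F × F)) (J : Finset F) :
    (↑J : Set F) ⊆ DBClosure T J :=
  Set.subset_sInter fun _ hK => hK.1

theorem dbClosure_subset {T : Finset (Finset F × F)} {J : Finset F} {K : Set F}
    (hJK : (↑J : Set F) ⊆ K) (hK : DBClosedSet T K) : DBClosure T J ⊆ K :=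
  Set.sInter_subset_of_mem ⟨hJK, hK⟩

theorem dbClosedSet_dbClosure (T : Finset (Finset F × F)) (J : Finset F) :
    DBClosedSet T (DBClosure T J) := fun r hr hrJ _ hK =>
  hK.2 r hr (hrJ.trans (Set.sInter_subset_of_mem hK))

theorem finite_dbClosure (T : Finset (Finset F × F)) (J : Finset F) :
    (DBClosure T J).Finite := by
  refine (J ∪ T.image Prod.snd).finite_toSet.subset (dbClosure_subset ?_ ?_)
  · exact Finset.coe_subset.2 Finset.subset_union_left
  · intro r hr _
    exact Finset.mem_coe.2
      (Finset.mem_union_right _ (Finset.mem_image_of_mem Prod.snd hr))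

theorem dbConsistentSet_coe {T : Finset (Finset F × F)} {D : Finset (Finset F)}
    {J : Finset F} : DBConsistentSet T D (↑J : Set F) ↔ DBConsistent T D J := by
  simp only [DBConsistentSet, DBClosedSet, DBConsistent, Finset.coe_subset, Finset.mem_coe]

theorem DBConsistentSet.dbClosure {T : Finset (Finset F × F)} {D : Finset (Finset F)}
    {J : Finset F} {K : Set F} (hK : DBConsistentSet T D K) (hJK : (↑J : Set F) ⊆ K) :
    DBConsistentSet T D (DBClosure T J) :=
  ⟨dbClosedSet_dbClosure T J,
    fun d hd hdJ => hK.2 d hd (hdJ.trans (dbClosure_subset hJK hK.1))⟩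

theorem mem_dbDelta {I J : Finset F} {x : F} :
    x ∈ DBDelta I J ↔ (x ∈ I ∧ x ∉ J) ∨ (x ∈ J ∧ x ∉ I) := by
  simp [DBDelta]

theorem DBRepair.dbClosure_inter_eq {T : Finset (Finset F × F)} {D : Finset (Finset F)}
    {I I' : Finset F} (h : DBRepair T D I I') :
    DBClosure T (I' ∩ I) = (↑I' : Set F) := by
  have hc := dbConsistentSet_coe.2 h.1
  have hsub : (↑(I' ∩ I) : Set F) ⊆ ↑I' := Finset.coe_subset.2 Finset.inter_subset_left
  have hle := dbClosure_subset hsub hc.1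
  have hge := subset_dbClosure T (I' ∩ I)
  have hcons := hc.dbClosure hsub
  lift DBClosure T (I' ∩ I) to Finset F using finite_dbClosure T (I' ∩ I) with J
  rw [Finset.coe_subset] at hle hge
  refine congrArg _ (hle.antisymm ?_)
  by_contra hlt
  obtain ⟨x, hx, hxJ⟩ := Finset.not_subset.1 hlt
  refine h.2 ⟨J, dbConsistentSet_coe.1 hcons,
    Finset.ssubset_iff_of_subset (fun y hy => ?_) |>.2 ⟨x, ?_, ?_⟩⟩
  · have := @hge y
    have := @hle y
    simp only [mem_dbDelta, Finset.mem_inter] at *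
    tauto
  all_goals
    have := @hge x
    simp only [mem_dbDelta, Finset.mem_inter] at *
    tauto

theorem DBRepair.not_exists_insert {T : Finset (Finset F × F)} {D : Finset (Finset F)}
    {I I' : Finset F} (h : DBRepair T D I I') :
    ¬ ∃ p ∈ I \ I',
      DBConsistentSet T D (DBClosure T (insert p I')) ∧
      DBClosure T (insert p I') \ (↑I : Set F) = (↑I' : Set F) \ (↑I : Set F) := by
  rintro ⟨p, hp, hcons, hdiff⟩
  have hge := subset_dbClosure T (insert p I')
  lift DBClosure T (insert p I') to Finset F using finite_dbClosure T (insert p I') with J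
  rw [Finset.coe_subset, Finset.insert_subset_iff] at hge
  rw [Finset.mem_sdiff] at hp
  refine h.2 ⟨J, dbConsistentSet_coe.1 hcons,
    Finset.ssubset_iff_of_subset (fun y hy => ?_) |>.2 ⟨p, ?_, ?_⟩⟩
  · have := @hge.2 y
    have := Set.ext_iff.1 hdiff y
    simp only [mem_dbDelta, Set.mem_sdiff, Finset.mem_coe] at *
    tauto
  all_goals
    simp only [mem_dbDelta]
    tauto

theorem dbRepair_of_dbClosure_inter_eq {T : Finset (Finset F × F)} {D : Finset (Finset F)}
    {I I' : Finset F} (hI' : DBConsistent T D I')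
    (hcl : DBClosure T (I' ∩ I) = (↑I' : Set F))
    (hmax : ¬ ∃ p ∈ I \ I',
      DBConsistentSet T D (DBClosure T (insert p I')) ∧
      DBClosure T (insert p I') \ (↑I : Set F) = (↑I' : Set F) \ (↑I : Set F)) :
    DBRepair T D I I' := by
  refine ⟨hI', ?_⟩
  rintro ⟨J, hJ, hlt⟩
  have hJs := dbConsistentSet_coe.2 hJ
  have hdelta : ∀ x, (x ∈ I ∧ x ∉ J) ∨ (x ∈ J ∧ x ∉ I) →
      (x ∈ I ∧ x ∉ I') ∨ (x ∈ I' ∧ x ∉ I) := fun x hx =>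
    mem_dbDelta.1 (hlt.subset (mem_dbDelta.2 hx))
  have hsub : I' ⊆ J := by
    rw [← Finset.coe_subset, ← hcl]
    refine dbClosure_subset (Finset.coe_subset.2 fun x hx => ?_) hJs.1
    have := hdelta x
    rw [Finset.mem_inter] at hx
    tauto
  have hne : ¬ J ⊆ I' := fun hle => by
    obtain rfl := hle.antisymm hsub
    exact hlt.ne rfl
  obtain ⟨p, hpJ, hpI'⟩ := Finset.not_subset.1 hne
  have hpI : p ∈ I := by
    have := hdelta p
    tauto
  have hins : (↑(insert p I') : Set F) ⊆ ↑J :=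
    Finset.coe_subset.2 (Finset.insert_subset hpJ hsub)
  refine hmax ⟨p, Finset.mem_sdiff.2 ⟨hpI, hpI'⟩, hJs.dbClosure hins, ?_⟩
  refine Set.Subset.antisymm (fun x hx => ?_) (Set.sdiff_subset_sdiff_left ?_)
  · have hxJ : x ∈ J := dbClosure_subset hins hJs.1 hx.1
    have hxI : x ∉ I := hx.2
    have := hdelta x
    exact ⟨Finset.mem_coe.2 (by tauto), hx.2⟩
  · exact (Finset.coe_subset.2 (Finset.subset_insert p I')).trans (subset_dbClosure T _)

/-- Lemma 1: `I'` is a repair of `I` iff (i) `I'` is consistent, (ii) `T*(I' ∩ I) = I'`,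
and (iii) there is no fact `p ∈ I ∖ I'` such that `J' = T*(I' ∪ {p})` is consistent and
`J' ∖ I = I' ∖ I`. -/
theorem repair_characterization
    (T : Finset (Finset F × F)) (D : Finset (Finset F))
    (hT : ∀ r ∈ T, r.1.Nonempty) (hD : ∀ d ∈ D, d.Nonempty)
    (I I' : Finset F) :
    DBRepair T D I I' ↔
      (DBConsistent T D I' ∧
       DBClosure T (I' ∩ I) = (↑I' : Set F) ∧
       ¬ ∃ p ∈ I \ I',
          DBConsistentSet T D (DBClosure T (insert p I')) ∧
          DBClosure T (insert p I') \ (↑I : Set F) = (↑I' : Set F) \ (↑I : Set F)) := by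
  exact ⟨fun h => ⟨h.1, h.dbClosure_inter_eq, h.not_exists_insert⟩,
    fun h => dbRepair_of_dbClosure_inter_eq h.1 h.2.1 h.2.2⟩
end

section
/- Correctness of supports (Proposition 'support' of the paper): Assume the acyclicity assumption. Then for every instance I, every repair I' of I, and every fact p, we have p ∈ I' if and only if there exists a support S ∈ Supp(p) with S ⊆ I'. -/
/-!
Setting: facts form a type `F` with decidable equality, instances are finite sets of facts.
`T` is a finite set of ground full TGD rules (body, head) with nonempty bodies,
`D` a finite set of ground denial rules (nonempty sets of facts).
Acyclicity: each fact carries a relation name `rel` and there is a rank `rk` on relation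
names such that bodies of TGD rules use only relation names of strictly smaller rank
than the head.
-/

variable {F : Type*} [DecidableEq F]

/-- `Supp T I p S`: `S` is a support of the fact `p` relative to the instance `I`.
(S0) if `p ∈ I` then `{p}` is a support of `p`;
(S1) if `p ∉ I`, `(S,p)` is a TGD rule, and each `q ∈ S` has a support `f q`,
then the union of the `f q` is a support of `p`. -/
inductive Supp (T : Finset (Finset F × F)) (I : Finset F) : F → Finset F → Prop
  | base {p : F} (hp : p ∈ I) : Supp T I p {p}
  | step {p : F} {S : Finset F} (f : F → Finset F)
      (hp : p ∉ I) (hS : (S, p) ∈ T) (hf : ∀ q ∈ S, Supp T I q (f q)) :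
      Supp T I p (S.biUnion f)

/-- A consistent instance containing a support of a fact contains the fact. -/
theorem Supp.mem_of_subset {T : Finset (Finset F × F)} {D : Finset (Finset F)}
    {I J : Finset F} (hJ : DBConsistent T D J) {p : F} {S : Finset F}
    (h : Supp T I p S) (hS : S ⊆ J) : p ∈ J := by
  induction h with
  | base _ => exact hS (Finset.mem_singleton_self _)
  | step f _ hT _ ih =>
    exact hJ.1 _ hT fun q hq => ih q hq ((Finset.subset_biUnion_of_mem f hq).trans hS)

open Classical in
/-- The facts of a consistent instance that have a support inside it form a consistent
instance. -/
theorem DBConsistent.filter_supported {T : Finset (Finset F × F)} {D : Finset (Finset F)}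
    {J : Finset F} (hJ : DBConsistent T D J) (I : Finset F) :
    DBConsistent T D (J.filter fun q => ∃ S, Supp T I q S ∧ S ⊆ J) := by
  refine ⟨?_, fun d hd hdJ => hJ.2 d hd (hdJ.trans (Finset.filter_subset _ _))⟩
  rintro ⟨B, q⟩ hr hB
  have hq : q ∈ J := hJ.1 _ hr (hB.trans (Finset.filter_subset _ _))
  refine Finset.mem_filter.2 ⟨hq, ?_⟩
  by_cases hqI : q ∈ I
  · exact ⟨{q}, .base hqI, Finset.singleton_subset_iff.2 hq⟩
  · have hsupp : ∀ b ∈ B, ∃ S, Supp T I b S ∧ S ⊆ J := fun b hb => (Finset.mem_filter.1 (hB hb)).2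
    choose! f hf hfJ using hsupp
    exact ⟨B.biUnion f, .step f hqI hr hf, Finset.biUnion_subset.2 hfJ⟩

/-- Dropping facts outside `I` from an instance, at least one of them, brings it strictly
closer to `I`. -/
theorem DBDelta_ssubset {I J K : Finset F} (hJK : J ⊆ K) (hI : ∀ q ∈ K, q ∈ I → q ∈ J)
    {p : F} (hpK : p ∈ K) (hpJ : p ∉ J) : DBDelta I J ⊂ DBDelta I K := by
  have hpI : p ∉ I := fun h => hpJ (hI p hpK h)
  refine Finset.ssubset_iff_subset_ne.2 ⟨fun q hq => ?_, fun h => ?_⟩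
  · simp only [DBDelta, Finset.mem_union, Finset.mem_sdiff] at hq ⊢
    exact hq.imp (fun h => ⟨h.1, fun hK => h.2 (hI q hK h.1)⟩) fun h => ⟨hJK h.1, h.2⟩
  · have hp : p ∈ DBDelta I K := by simp [DBDelta, hpK, hpI]
    rw [← h] at hp
    simp [DBDelta, hpI, hpJ] at hp

/-- Proposition (supports): under the acyclicity assumption, for every repair `I'` of `I`
and every fact `p`, `p ∈ I'` iff some support of `p` is contained in `I'`. -/
theorem support_correct {R : Type*} (rel : F → R) (rk : R → ℕ)
    (T : Finset (Finset F × F)) (D : Finset (Finset F))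
    (hT : ∀ r ∈ T, r.1.Nonempty) (hD : ∀ d ∈ D, d.Nonempty)
    (hacyc : ∀ r ∈ T, ∀ q ∈ r.1, rk (rel q) < rk (rel r.2))
    (I I' : Finset F) (hrep : DBRepair T D I I') (p : F) :
    p ∈ I' ↔ ∃ S : Finset F, Supp T I p S ∧ S ⊆ I' := by
  classical
  refine ⟨fun hp => ?_, fun ⟨S, h, hS⟩ => h.mem_of_subset hrep.1 hS⟩
  by_contra hno
  refine hrep.2 ⟨_, hrep.1.filter_supported I,
    DBDelta_ssubset (Finset.filter_subset _ _) (fun q hq hqI => ?_) hp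
      fun h => hno (Finset.mem_filter.1 h).2⟩
  exact Finset.mem_filter.2 ⟨hq, {q}, .base hqI, Finset.singleton_subset_iff.2 hq⟩
end

section
/- Repairs under denial constraints are exactly the maximal conflict-free subsets (Proposition 2 of the paper): Suppose every conflict in C has empty negative part, i.e., every conflict is of the form (P,∅). Then for all instances I and I', the instance I' is a repair of I if and only if I' ⊆ I, no conflict (P,∅) ∈ C satisfies P ⊆ I', and for every instance J with I' ⊊ J ⊆ I some conflict (P,∅) ∈ C satisfies P ⊆ J. -/
/-!
Setting: facts form a type `F` with decidable equality, instances are finite sets of facts.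
`C` is a set of conflicts, each a pair `(P,N)` of finite sets of facts with `P` nonempty
and `P ∩ N = ∅`.
-/

variable {F : Type*} [DecidableEq F]

/-- An instance `J` is consistent: no conflict `(P,N) ∈ C` has `P ⊆ J` and `N ∩ J = ∅`. -/
def CConsistent (C : Set (Finset F × Finset F)) (J : Finset F) : Prop :=
  ¬ ∃ c ∈ C, c.1 ⊆ J ∧ c.2 ∩ J = ∅

/-- Symmetric difference `Δ(I,J) = (I∖J) ∪ (J∖I)` of two instances. -/
def CDelta (I J : Finset F) : Finset F := (I \ J) ∪ (J \ I)

/-- `I'` is a repair of `I`: a consistent instance such that no consistent instance `J`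
satisfies `Δ(I,J) ⊊ Δ(I,I')`. -/
def CRepair (C : Set (Finset F × Finset F)) (I I' : Finset F) : Prop :=
  CConsistent C I' ∧ ¬ ∃ J : Finset F, CConsistent C J ∧ CDelta I J ⊂ CDelta I I'

/-- Under denial constraints, an instance is consistent iff it contains no conflict. -/
theorem cConsistent_iff_of_denial {C : Set (Finset F × Finset F)} (hden : ∀ c ∈ C, c.2 = ∅)
    {J : Finset F} : CConsistent C J ↔ ∀ c ∈ C, ¬ c.1 ⊆ J := by
  constructor
  · intro h c hc hJ
    exact h ⟨c, hc, hJ, by simp [hden c hc]⟩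
  · rintro h ⟨c, hc, hJ, -⟩
    exact h c hc hJ

theorem mem_cDelta {I J : Finset F} {x : F} :
    x ∈ CDelta I J ↔ x ∈ I ∧ x ∉ J ∨ x ∈ J ∧ x ∉ I := by
  simp [CDelta]

/-- Instances strictly closer to `I` than a subset `I'` are those strictly between them. -/
theorem cDelta_ssubset_cDelta_iff {I I' J : Finset F} (h : I' ⊆ I) :
    CDelta I J ⊂ CDelta I I' ↔ I' ⊂ J ∧ J ⊆ I := by
  simp only [Finset.ssubset_def, Finset.subset_iff, mem_cDelta] at h ⊢
  grind

/-- Discarding the facts outside `I` from an instance not contained in `I` brings it strictly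
closer to `I`. -/
theorem cDelta_inter_ssubset {I I' : Finset F} (h : ¬ I' ⊆ I) :
    CDelta I (I' ∩ I) ⊂ CDelta I I' := by
  simp only [Finset.ssubset_def, Finset.subset_iff, mem_cDelta, Finset.mem_inter] at h ⊢
  grind

/-- Proposition 2: if every conflict has empty negative part, then `I'` is a repair of `I`
iff `I' ⊆ I`, no conflict's positive part is contained in `I'`, and every `J` with
`I' ⊊ J ⊆ I` contains the positive part of some conflict. -/
theorem denial_repairs_are_maximal_consistent_subsets
    (C : Set (Finset F × Finset F))
    (hC : ∀ c ∈ C, c.1.Nonempty ∧ c.1 ∩ c.2 = ∅)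
    (hden : ∀ c ∈ C, c.2 = ∅)
    (I I' : Finset F) :
    CRepair C I I' ↔
      (I' ⊆ I ∧ (∀ c ∈ C, ¬ c.1 ⊆ I') ∧
        ∀ J : Finset F, I' ⊂ J → J ⊆ I → ∃ c ∈ C, c.1 ⊆ J) := by
  simp only [CRepair, cConsistent_iff_of_denial hden]
  constructor
  · rintro ⟨hcons, hmin⟩
    have hsub : I' ⊆ I := by
      by_contra h
      exact hmin ⟨I' ∩ I, fun c hc hcI => hcons c hc (hcI.trans Finset.inter_subset_left),
        cDelta_inter_ssubset h⟩
    refine ⟨hsub, hcons, fun J hJ hJI => ?_⟩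
    by_contra! h
    exact hmin ⟨J, h, (cDelta_ssubset_cDelta_iff hsub).2 ⟨hJ, hJI⟩⟩
  · rintro ⟨hsub, hcons, hmax⟩
    refine ⟨hcons, ?_⟩
    rintro ⟨J, hJ, hlt⟩
    obtain ⟨hIJ, hJI⟩ := (cDelta_ssubset_cDelta_iff hsub).1 hlt
    obtain ⟨c, hc, hcJ⟩ := hmax J hIJ hJI
    exact hJ c hc hcJ
end

section
/- Existence of repairs: For every instance I, the set of repairs of I with respect to the conflict set C is nonempty. -/
/-!
Setting: facts form a type `F` with decidable equality, instances are finite sets of facts.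
`C` is a set of conflicts, each a pair `(P,N)` of finite sets of facts with `P` nonempty
and `P ∩ N = ∅`.
-/

variable {F : Type*} [DecidableEq F]

/-- Existence of repairs: every instance `I` has at least one repair w.r.t. `C`. -/
theorem repair_exists
    (C : Set (Finset F × Finset F))
    (hC : ∀ c ∈ C, c.1.Nonempty ∧ c.1 ∩ c.2 = ∅)
    (I : Finset F) :
    ∃ I' : Finset F, CRepair C I I' := by
  have hempty : CConsistent C ∅ := by
    rintro ⟨c, hc, hP, -⟩
    exact (hC c hc).1.ne_empty (Finset.subset_empty.mp hP)
  obtain ⟨I', hI', hmin⟩ := (InvImage.wf (CDelta I) wellFounded_lt).has_min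
    {J | CConsistent C J} ⟨∅, hempty⟩
  exact ⟨I', hI', fun ⟨J, hJ, hlt⟩ => hmin J hJ hlt⟩
end

section
/- Correctness of the ∀∃QBF reduction (main claim in the proof of Theorem 5 of the paper): With the instance I_Ψ and the conflict set C constructed from the quantified Boolean formula Ψ as described, the formula Ψ = ∀x₁…xₙ ∃x_{n+1}…x_{n+m}. Φ is valid (for every truth assignment to x₁,…,xₙ there is a truth assignment to x_{n+1},…,x_{n+m} under which Φ evaluates to true) if and only if every repair of I_Ψ contains the fact r̄. -/
/-!
Construction from a ∀∃ quantified Boolean formula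
`Ψ = ∀x₁…xₙ ∃x_{n+1}…x_{n+m}. Φ` where `Φ = C₁ ∧ … ∧ C_k` is in 3CNF.
A literal over the variables `Fin (n+m)` is a pair `(i, s) : Fin (n+m) × Bool`
(`s = true` for the positive literal `xᵢ`, `s = false` for `¬xᵢ`); the clauses are
given by `Cl : Fin k → Fin 3 → Fin (n+m) × Bool`.
Facts are `pᵢ = pv i true`, `p̄ᵢ = pv i false`, `qⱼ`, `r`, and `r̄`.
-/

/-- The type of facts of the reduction (`N` variables, `k` clauses). -/
abbrev QFact (N k : ℕ) : Type := (Fin N × Bool) ⊕ (Fin k ⊕ Bool)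

/-- `pv i true = pᵢ` and `pv i false = p̄ᵢ`. -/
def pv {N k : ℕ} (i : Fin N) (s : Bool) : QFact N k := Sum.inl (i, s)

/-- `ℓ(L)`: the fact corresponding to the satisfying valuation of the literal `L`. -/
def litf {N k : ℕ} (L : Fin N × Bool) : QFact N k := Sum.inl L

/-- The fact `qⱼ` for the clause `Cⱼ`. -/
def qc {N k : ℕ} (j : Fin k) : QFact N k := Sum.inr (Sum.inl j)

/-- The special fact `r`. -/
def rpos {N k : ℕ} : QFact N k := Sum.inr (Sum.inr true)

/-- The special fact `r̄`. -/
def rbar {N k : ℕ} : QFact N k := Sum.inr (Sum.inr false)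

variable {F : Type*} [DecidableEq F]

/-- The conflict set of the reduction:
`({pᵢ,p̄ᵢ},∅)` for every `i`; `({r,r̄},∅)`; `({pᵢ,r},∅)` and `({p̄ᵢ,r},∅)` for every
existential variable `i ∈ {n+1,…,n+m}`; and
`({qⱼ}, {ℓ(Lⱼ₁), ℓ(Lⱼ₂), ℓ(Lⱼ₃), r})` for every clause `Cⱼ`. -/
def CPsi (n m k : ℕ) (Cl : Fin k → Fin 3 → Fin (n + m) × Bool) :
    Set (Finset (QFact (n + m) k) × Finset (QFact (n + m) k)) :=
  {c | (∃ i : Fin (n + m), c = ({pv i true, pv i false}, ∅)) ∨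
       c = ({rpos, rbar}, ∅) ∨
       (∃ i : Fin (n + m), n ≤ (i : ℕ) ∧
          (c = ({pv i true, rpos}, ∅) ∨ c = ({pv i false, rpos}, ∅))) ∨
       (∃ j : Fin k,
          c = ({qc j}, {litf (Cl j 0), litf (Cl j 1), litf (Cl j 2), rpos}))}

/-- The instance `I_Ψ = { pᵢ, p̄ᵢ : 1 ≤ i ≤ n+m } ∪ { q₁,…,q_k } ∪ { r̄ }`. -/
def IPsi (n m k : ℕ) : Finset (QFact (n + m) k) :=
  (Finset.univ.image fun x : Fin (n + m) × Bool => (litf x : QFact (n + m) k))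
  ∪ (Finset.univ.image fun j : Fin k => (qc j : QFact (n + m) k)) ∪ {rbar}

theorem rbar_ne_rpos {N k : ℕ} : (rbar : QFact N k) ≠ rpos := by
  simp [rbar, rpos]

theorem CConsistent_CPsi_iff {n m k : ℕ} {Cl : Fin k → Fin 3 → Fin (n + m) × Bool}
    {J : Finset (QFact (n + m) k)} :
    CConsistent (CPsi n m k Cl) J ↔
      (∀ i, litf (i, true) ∈ J → litf (i, false) ∉ J) ∧
      (rpos ∈ J → rbar ∉ J) ∧
      (∀ i : Fin (n + m), n ≤ (i : ℕ) → ∀ s, litf (i, s) ∈ J → rpos ∉ J) ∧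
      (∀ j, qc j ∈ J → (∃ t, litf (Cl j t) ∈ J) ∨ rpos ∈ J) := by
  unfold CConsistent CPsi
  constructor
  · intro h
    refine ⟨fun i h1 h2 => h ⟨_, Or.inl ⟨i, rfl⟩, ?_, by simp⟩,
      fun h1 h2 => h ⟨_, Or.inr (Or.inl rfl), ?_, by simp⟩, fun i hi s h1 h2 => ?_,
      fun j hj => ?_⟩
    · simpa [Finset.insert_subset_iff] using ⟨h1, h2⟩
    · simpa [Finset.insert_subset_iff] using ⟨h1, h2⟩
    · cases s
      · refine h ⟨_, Or.inr (Or.inr (Or.inl ⟨i, hi, Or.inr rfl⟩)), ?_, by simp⟩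
        simpa [Finset.insert_subset_iff] using ⟨h1, h2⟩
      · refine h ⟨_, Or.inr (Or.inr (Or.inl ⟨i, hi, Or.inl rfl⟩)), ?_, by simp⟩
        simpa [Finset.insert_subset_iff] using ⟨h1, h2⟩
    · by_contra! hc
      refine h ⟨_, Or.inr (Or.inr (Or.inr ⟨j, rfl⟩)), by simpa using hj, ?_⟩
      rw [← Finset.disjoint_iff_inter_eq_empty]
      simp [hc.1, hc.2]
  · rintro ⟨h1, h2, h3, h4⟩ ⟨c, hc, hP, hN⟩
    rcases hc with ⟨i, rfl⟩ | rfl | ⟨i, hi, rfl | rfl⟩ | ⟨j, rfl⟩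
    · simp only [Finset.insert_subset_iff, Finset.singleton_subset_iff] at hP
      exact h1 i hP.1 hP.2
    · simp only [Finset.insert_subset_iff, Finset.singleton_subset_iff] at hP
      exact h2 hP.1 hP.2
    · simp only [Finset.insert_subset_iff, Finset.singleton_subset_iff] at hP
      exact h3 i hi _ hP.1 hP.2
    · simp only [Finset.insert_subset_iff, Finset.singleton_subset_iff] at hP
      exact h3 i hi _ hP.1 hP.2
    · rw [← Finset.disjoint_iff_inter_eq_empty] at hN
      simp only [Finset.disjoint_insert_left, Finset.disjoint_singleton_left] at hN
      rcases h4 j (by simpa using hP) with ⟨t, ht⟩ | hr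
      · fin_cases t
        · exact hN.1 ht
        · exact hN.2.1 ht
        · exact hN.2.2.1 ht
      · exact hN.2.2.2 hr

/-- Membership in `Δ(I_Ψ, J)` fact by fact: everything but `r` belongs to `I_Ψ`. -/
theorem mem_CDelta_IPsi {n m k : ℕ} {J : Finset (QFact (n + m) k)} {x : QFact (n + m) k} :
    x ∈ CDelta (IPsi n m k) J ↔ (x ≠ rpos ∧ x ∉ J) ∨ (x = rpos ∧ x ∈ J) := by
  have hx : x ∈ IPsi n m k ↔ x ≠ rpos := by
    rcases x with x | j | b
    · simp [IPsi, litf, rpos]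
    · simp [IPsi, qc, rpos]
    · cases b <;> simp [IPsi, litf, qc, rpos, rbar]
  simp only [CDelta, Finset.mem_union, Finset.mem_sdiff, hx]
  tauto

/-- Correctness of the ∀∃QBF reduction: `Ψ` is valid iff every repair of `I_Ψ`
contains the fact `r̄`. -/
theorem qbf_reduction (n m k : ℕ) (Cl : Fin k → Fin 3 → Fin (n + m) × Bool) :
    (∀ v : Fin (n + m) → Bool, ∃ w : Fin (n + m) → Bool,
        (∀ i : Fin (n + m), (i : ℕ) < n → w i = v i) ∧
        ∀ j : Fin k, ∃ t : Fin 3, w (Cl j t).1 = (Cl j t).2) ↔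
      ∀ I' : Finset (QFact (n + m) k),
        CRepair (CPsi n m k Cl) (IPsi n m k) I' → rbar ∈ I' := by
  constructor
  · rintro hΨ I' ⟨hI, hmin⟩
    by_contra hb
    rw [CConsistent_CPsi_iff] at hI
    obtain ⟨h1, -, h3, h4⟩ := hI
    by_cases hr : rpos ∈ I'
    · obtain ⟨w, hw, hsat⟩ := hΨ fun i => decide (litf (i, true) ∈ I')
      have hnot : ∀ i, litf (i, !w i) ∉ I' := by
        intro i hi
        by_cases hin : (i : ℕ) < n
        · rw [hw i hin] at hi
          by_cases ht : litf (i, true) ∈ I'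
          · exact h1 i ht (by simpa [ht] using hi)
          · simp [ht] at hi
        · exact h3 i (not_lt.mp hin) _ hi hr
      set J : Finset (QFact (n + m) k) := Finset.univ.filter fun x =>
        (∃ i, x = litf (i, w i)) ∨ (∃ j, x = qc j) ∨ x = rbar with hJ
      have hl : ∀ i s, litf (i, s) ∈ J ↔ s = w i := by
        intro i s
        simp only [hJ, Finset.mem_filter_univ]
        simp [litf, qc, rbar]
      have hq : ∀ j, qc j ∈ J := by simp [hJ]
      have hbJ : rbar ∈ J := by simp [hJ]
      have hrJ : rpos ∉ J := by
        simp only [hJ, Finset.mem_filter_univ]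
        simp [litf, qc, rbar, rpos]
      refine hmin ⟨J, ?_, ?_⟩
      · rw [CConsistent_CPsi_iff]
        refine ⟨fun i => ?_, fun h => absurd h hrJ, fun _ _ _ _ => hrJ, fun j _ => Or.inl ?_⟩
        · rw [hl, hl]
          intro h
          simp [← h]
        · obtain ⟨t, ht⟩ := hsat j
          exact ⟨t, (hl _ _).2 ht.symm⟩
      · rw [Finset.ssubset_iff_of_subset]
        · refine ⟨rbar, ?_, ?_⟩ <;> rw [mem_CDelta_IPsi]
          · exact Or.inl ⟨rbar_ne_rpos, hb⟩
          · simp [hbJ, rbar_ne_rpos]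
        · intro x
          rw [mem_CDelta_IPsi, mem_CDelta_IPsi]
          rintro (⟨hx, hxJ⟩ | ⟨rfl, hxJ⟩)
          · refine Or.inl ⟨hx, ?_⟩
            rcases x with ⟨i, s⟩ | j | b
            · have hs : s = !w i := by
                have := mt (hl i s).2 hxJ
                cases s <;> cases h : w i <;> simp_all
              subst hs
              exact hnot i
            · exact absurd (hq j) hxJ
            · cases b
              · exact absurd hbJ hxJ
              · exact absurd rfl hx
          · exact absurd hxJ hrJ
    · refine hmin ⟨insert rbar I', ?_, ?_⟩
      · have hr' : rpos ∉ insert rbar I' := by simp [hr, rbar_ne_rpos.symm]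
        rw [CConsistent_CPsi_iff]
        refine ⟨fun i => ?_, fun h => absurd h hr', fun _ _ _ _ => hr', fun j hj => Or.inl ?_⟩
        · simpa [litf, rbar] using h1 i
        · obtain ⟨t, ht⟩ := (h4 j (by simpa [qc, rbar] using hj)).resolve_right hr
          exact ⟨t, Finset.mem_insert_of_mem ht⟩
      · rw [Finset.ssubset_iff_of_subset]
        · refine ⟨rbar, ?_, ?_⟩ <;> rw [mem_CDelta_IPsi]
          · exact Or.inl ⟨rbar_ne_rpos, hb⟩
          · simp [rbar_ne_rpos]
        · intro x
          rw [mem_CDelta_IPsi, mem_CDelta_IPsi, Finset.mem_insert]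
          rintro (⟨hx, hxJ⟩ | ⟨rfl, hxJ⟩)
          · exact Or.inl ⟨hx, fun h => hxJ (Or.inr h)⟩
          · exact Or.inr ⟨rfl, hxJ.resolve_left rbar_ne_rpos.symm⟩
  · intro hrep
    by_contra! hΨ
    obtain ⟨v, hv⟩ := hΨ
    set I' : Finset (QFact (n + m) k) := Finset.univ.filter fun x =>
      (∃ i : Fin (n + m), (i : ℕ) < n ∧ x = litf (i, v i)) ∨ (∃ j, x = qc j) ∨ x = rpos with hI'
    have hl : ∀ i s, litf (i, s) ∈ I' ↔ (i : ℕ) < n ∧ s = v i := by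
      intro i s
      simp only [hI', Finset.mem_filter_univ]
      constructor
      · rintro (⟨i', hi', h⟩ | ⟨j, h⟩ | h)
        · simp only [litf, Sum.inl.injEq, Prod.mk.injEq] at h
          obtain ⟨rfl, rfl⟩ := h
          exact ⟨hi', rfl⟩
        · simp [litf, qc] at h
        · simp [litf, rpos] at h
      · rintro ⟨hi, rfl⟩
        exact Or.inl ⟨i, hi, rfl⟩
    have hq : ∀ j, qc j ∈ I' := by simp [hI']
    have hr : rpos ∈ I' := by simp [hI']
    have hb : rbar ∉ I' := by
      simp only [hI', Finset.mem_filter_univ]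
      simp [litf, qc, rbar, rpos]
    refine hb (hrep I' ⟨?_, ?_⟩)
    · rw [CConsistent_CPsi_iff]
      refine ⟨fun i => ?_, fun _ => hb, fun i hi s h => ?_, fun _ _ => Or.inr hr⟩
      · rw [hl, hl]
        rintro ⟨-, h⟩
        simp [← h]
      · exact absurd ((hl i s).1 h).1 (not_lt.mpr hi)
    · rintro ⟨J, hJ, hsub, hne⟩
      rw [CConsistent_CPsi_iff] at hJ
      obtain ⟨h1, h2, h3, h4⟩ := hJ
      have hmem : ∀ x, x ≠ rpos → x ∈ I' → x ∈ J := by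
        intro x hx hxI
        by_contra hxJ
        have := hsub (mem_CDelta_IPsi.2 (Or.inl ⟨hx, hxJ⟩))
        rw [mem_CDelta_IPsi] at this
        tauto
      have hlJ : ∀ i : Fin (n + m), (i : ℕ) < n → litf (i, v i) ∈ J := fun i hi =>
        hmem _ (by simp [litf, rpos]) ((hl _ _).2 ⟨hi, rfl⟩)
      have hfun : ∀ i s, litf (i, s) ∈ J → litf (i, !s) ∉ J := by
        rintro i (_ | _) h h'
        · exact h1 i h' h
        · exact h1 i h h'
      by_cases hrJ : rpos ∈ J
      · refine hne fun x hx => ?_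
        rw [mem_CDelta_IPsi] at hx ⊢
        rcases hx with ⟨hx, hxI⟩ | ⟨rfl, -⟩
        · refine Or.inl ⟨hx, fun hxJ => ?_⟩
          rcases x with ⟨i, s⟩ | j | b
          · by_cases hi : (i : ℕ) < n
            · have hs : s ≠ v i := fun h => hxI ((hl i s).2 ⟨hi, h⟩)
              refine hfun i _ (hlJ i hi) ?_
              rwa [← Bool.eq_not.2 hs]
            · exact h3 i (not_lt.mp hi) s hxJ hrJ
          · exact hxI (hq j)
          · cases b
            · exact h2 hrJ hxJ
            · exact hx rfl
        · exact Or.inr ⟨rfl, hrJ⟩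
      · have hw : ∀ i s, litf (i, s) ∈ J → decide (litf (i, true) ∈ J) = s := by
          rintro i (_ | _) h
          · simpa using fun h' => h1 i h' h
          · simpa using h
        obtain ⟨j, hj⟩ := hv (fun i => decide (litf (i, true) ∈ J))
          fun i hi => hw i _ (hlJ i hi)
        obtain ⟨t, ht⟩ := (h4 j (hmem _ (by simp [qc, rpos]) (hq j))).resolve_right hrJ
        exact hj t (hw _ _ ht)
end
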